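/- Let ω : ℝ → ℝ be an odd Schwartz function and H its Hilbert transform, H(ω)(x) = (1/π) P.V. ∫_ℝ ω(y)/(x-y) dy. Then (1/π) ∫_ℝ (H(ω)(x) · ω(x))/x dx = -(1/2) (H(ω)(0))². -/

import Mathlib

open MeasureTheory Filter

/-- The Hilbert transform integral truncated at distance `ε` from the singularity. -/
noncomputable def truncatedHilbert (f : ℝ → ℝ) (ε x : ℝ) : ℝ :=
  ∫ y in {y : ℝ | ε < |x - y|}, f y / (x - y)

lemma measurableSet_lt_abs_sub (ε x : ℝ) : MeasurableSet {y : ℝ | ε < |x - y|} :=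
  measurableSet_lt measurable_const (by fun_prop)

lemma SchwartzMap.exists_lipschitzWith (f : SchwartzMap ℝ ℝ) : ∃ L, LipschitzWith L f := by
  obtain ⟨C, hC, hbound⟩ := (SchwartzMap.derivCLM ℝ ℝ f).decay 0 0
  refine ⟨⟨C, hC.le⟩, lipschitzWith_of_nnnorm_deriv_le f.differentiable fun x => ?_⟩
  have h := hbound x
  simp only [pow_zero, one_mul, norm_iteratedFDeriv_zero, SchwartzMap.derivCLM_apply] at h
  exact h

lemma integrable_indicator_Icc_const (c : ℝ) :
    Integrable ((Set.Icc (-1 : ℝ) 1).indicator fun _ => c) :=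
  (integrable_indicator_iff measurableSet_Icc).2 (integrableOn_const (by simp))

lemma abs_div_le_indicator_add {a t c d : ℝ} (hc : |a| ≤ c * |t|) (hc0 : 0 ≤ c) (hd : |a| ≤ d) :
    |a / t| ≤ (Set.Icc (-1 : ℝ) 1).indicator (fun _ => c) t + d := by
  have hd0 : 0 ≤ d := (abs_nonneg a).trans hd
  rw [abs_div]
  by_cases ht : t ∈ Set.Icc (-1 : ℝ) 1
  · rw [Set.indicator_of_mem ht]
    linarith [div_le_of_le_mul₀ (abs_nonneg t) hc0 hc]
  · rw [Set.indicator_of_notMem ht, zero_add]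
    have h1 : 1 ≤ |t| := by
      by_contra! h
      exact ht (abs_le.1 h.le)
    exact (div_le_self (abs_nonneg a) h1).trans hd

lemma LipschitzWith.integrable_div_self {f : ℝ → ℝ} {L : NNReal} (hL : LipschitzWith L f)
    (hf : Integrable f) (h0 : f 0 = 0) : Integrable fun x => f x / x := by
  refine ((integrable_indicator_Icc_const L).add hf.abs).mono'
    (hL.continuous.measurable.div measurable_id).aestronglyMeasurable
    (Eventually.of_forall fun x => ?_)
  refine abs_div_le_indicator_add ?_ L.2 le_rfl
  simpa [h0, Real.dist_eq] using hL.dist_le_mul x 0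

lemma integrable_indicator_div_sub {f : ℝ → ℝ} (hf : Integrable f) {ε : ℝ} (hε : 0 < ε) (x : ℝ) :
    Integrable ({y : ℝ | ε < |x - y|}.indicator fun y => f y / (x - y)) := by
  refine (hf.abs.div_const ε).mono'
    ((hf.aestronglyMeasurable.mul (by fun_prop : Measurable fun y : ℝ =>
      (x - y)⁻¹).aestronglyMeasurable).indicator (measurableSet_lt_abs_sub ε x))
    (Eventually.of_forall fun y => ?_)
  by_cases hy : ε < |x - y|
  · rw [Set.indicator_of_mem (by exact hy), Real.norm_eq_abs, abs_div]
    gcongr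
  · rw [Set.indicator_of_notMem (by exact hy), norm_zero]
    positivity

lemma two_mul_truncatedHilbert {f : ℝ → ℝ} (hf : Integrable f) {ε : ℝ} (hε : 0 < ε) (x : ℝ) :
    2 * truncatedHilbert f ε x =
      ∫ t, {t : ℝ | ε < |t|}.indicator (fun t => (f (x - t) - f (x + t)) / t) t := by
  have hI := integrable_indicator_div_sub hf hε x
  have h1 : truncatedHilbert f ε x =
      ∫ t, {y : ℝ | ε < |x - y|}.indicator (fun y => f y / (x - y)) (x - t) := by
    rw [truncatedHilbert, ← integral_indicator (measurableSet_lt_abs_sub ε x),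
      integral_sub_left_eq_self (fun y => {y : ℝ | ε < |x - y|}.indicator
        (fun y => f y / (x - y)) y) volume x]
  have h2 : truncatedHilbert f ε x =
      ∫ t, {y : ℝ | ε < |x - y|}.indicator (fun y => f y / (x - y)) (x + t) := by
    rw [truncatedHilbert, ← integral_indicator (measurableSet_lt_abs_sub ε x),
      integral_add_left_eq_self (fun y => {y : ℝ | ε < |x - y|}.indicator
        (fun y => f y / (x - y)) y) x]
  rw [two_mul]
  nth_rewrite 1 [h1]
  rw [h2, ← integral_add (hI.comp_sub_left x) (hI.comp_add_left x)]
  congr 1 with t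
  by_cases ht : ε < |t|
  · simp [Set.indicator, ht]
    ring
  · simp [Set.indicator, ht]

lemma LipschitzWith.abs_truncatedHilbert_le {f : ℝ → ℝ} {L : NNReal} (hL : LipschitzWith L f)
    (hf : Integrable f) {ε : ℝ} (hε : 0 < ε) (x : ℝ) :
    |truncatedHilbert f ε x| ≤ 2 * L + ∫ y, |f y| := by
  have hsub := hf.abs.comp_sub_left x
  have hadd := hf.abs.comp_add_left x
  have hbound : ∀ t : ℝ,
      ‖{t : ℝ | ε < |t|}.indicator (fun t => (f (x - t) - f (x + t)) / t) t‖ ≤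
        (Set.Icc (-1 : ℝ) 1).indicator (fun _ => (2 * L : ℝ)) t +
          (|f (x - t)| + |f (x + t)|) := fun t => by
    refine (norm_indicator_le_norm_self _ t).trans
      (abs_div_le_indicator_add ?_ (by positivity) (abs_sub _ _))
    have h := hL.dist_le_mul (x - t) (x + t)
    rw [Real.dist_eq, Real.dist_eq, show x - t - (x + t) = -(2 * t) by ring, abs_neg, abs_mul,
      abs_two] at h
    linarith
  have h := norm_integral_le_of_norm_le
    ((integrable_indicator_Icc_const (2 * L)).add (hsub.add hadd)) (Eventually.of_forall hbound)
  rw [← two_mul_truncatedHilbert hf hε, integral_add' (integrable_indicator_Icc_const (2 * L))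
    (hsub.add hadd), integral_add' hsub hadd, integral_sub_left_eq_self (fun y => |f y|) volume x,
    integral_add_left_eq_self (fun y => |f y|) x, integral_indicator measurableSet_Icc,
    Real.norm_eq_abs, abs_mul, abs_two] at h
  simp at h
  linarith

lemma tendsto_setIntegral_lt_abs_sub {g : ℝ → ℝ} (hg : Integrable g) (x : ℝ) :
    Tendsto (fun ε : ℝ => ∫ y in {y : ℝ | ε < |x - y|}, g y)
      (nhdsWithin 0 (Set.Ioi 0)) (nhds (∫ y, g y)) := by
  simp_rw [← integral_indicator (measurableSet_lt_abs_sub _ x)]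
  refine tendsto_integral_filter_of_dominated_convergence (fun y => ‖g y‖)
    (Eventually.of_forall fun ε =>
      hg.aestronglyMeasurable.indicator (measurableSet_lt_abs_sub ε x))
    (Eventually.of_forall fun ε => Eventually.of_forall fun y => norm_indicator_le_norm_self _ y)
    hg.norm ?_
  filter_upwards [Measure.ae_ne volume x] with y hy
  refine tendsto_const_nhds.congr' ?_
  have hpos : 0 < |x - y| := abs_pos.2 (sub_ne_zero.2 hy.symm)
  filter_upwards [mem_nhdsWithin_of_mem_nhds (Iio_mem_nhds hpos)] with ε hε
  exact (Set.indicator_of_mem (by exact hε) g).symm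

lemma integrable_prod_truncated {f g : ℝ → ℝ} (hf : Integrable f) (hg : Integrable g) {ε : ℝ}
    (hε : 0 < ε) :
    Integrable (fun p : ℝ × ℝ => {p : ℝ × ℝ | ε < |p.1 - p.2|}.indicator
      (fun p => g p.1 * f p.2 / (p.1 - p.2)) p) (volume.prod volume) := by
  have hgf := hg.mul_prod hf
  have hs : MeasurableSet {p : ℝ × ℝ | ε < |p.1 - p.2|} :=
    measurableSet_lt measurable_const (by fun_prop)
  refine (hgf.norm.div_const ε).mono'
    ((hgf.aestronglyMeasurable.mul (by fun_prop : Measurable fun p : ℝ × ℝ =>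
      (p.1 - p.2)⁻¹).aestronglyMeasurable).indicator hs)
    (Eventually.of_forall fun p => ?_)
  by_cases hp : ε < |p.1 - p.2|
  · rw [Set.indicator_of_mem (by exact hp), norm_div, Real.norm_eq_abs (p.1 - p.2)]
    gcongr
  · rw [Set.indicator_of_notMem (by exact hp), norm_zero]
    positivity

lemma integral_indicator_prod_truncated (f g : ℝ → ℝ) (ε x : ℝ) :
    ∫ y, {p : ℝ × ℝ | ε < |p.1 - p.2|}.indicator (fun p => g p.1 * f p.2 / (p.1 - p.2)) (x, y) =
      truncatedHilbert f ε x * g x := by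
  rw [truncatedHilbert, ← integral_indicator (measurableSet_lt_abs_sub ε x), ← integral_mul_const]
  congr 1 with y
  by_cases hy : ε < |x - y|
  · simp [Set.indicator, hy]
    ring
  · simp [Set.indicator, hy]

lemma two_mul_integral_truncatedHilbert_mul {f g : ℝ → ℝ} (hf : Integrable f) (hg : Integrable g)
    (hfg : ∀ x, f x = x * g x) {ε : ℝ} (hε : 0 < ε) :
    2 * ∫ x, truncatedHilbert f ε x * g x =
      -∫ x, g x * ∫ y in {y : ℝ | ε < |x - y|}, g y := by
  have hK := integrable_prod_truncated hf hg hε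
  have h1 := integral_prod _ hK
  simp only [integral_indicator_prod_truncated] at h1
  have hs : MeasurableSet {p : ℝ × ℝ | ε < |p.1 - p.2|} :=
    measurableSet_lt measurable_const (by fun_prop)
  have hG := integral_prod _ ((hg.mul_prod hg).indicator hs)
  have hinner : ∀ x, ∫ y, {p : ℝ × ℝ | ε < |p.1 - p.2|}.indicator
      (fun p => g p.1 * g p.2) (x, y) = g x * ∫ y in {y : ℝ | ε < |x - y|}, g y := fun x => by
    rw [← integral_indicator (measurableSet_lt_abs_sub ε x), ← integral_const_mul]
    congr 1 with y
    simp [Set.indicator]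
  simp only [hinner] at hG
  rw [← h1, ← hG, two_mul]
  nth_rewrite 2 [← integral_prod_swap]
  refine (integral_add hK hK.swap).symm.trans ?_
  rw [← integral_neg]
  congr 1 with p
  by_cases hp : ε < |p.1 - p.2|
  · have hne : p.1 - p.2 ≠ 0 := abs_pos.1 (hε.trans hp)
    have hp' : ε < |p.2 - p.1| := by rwa [abs_sub_comm]
    simp only [Set.indicator, Set.mem_ofPred_eq, hp, hp', if_true, Prod.fst_swap, Prod.snd_swap,
      Function.comp_apply, hfg]
    rw [← neg_sub p.1 p.2]
    field_simp
    ring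
  · have hp' : ¬ ε < |p.2 - p.1| := by rwa [abs_sub_comm]
    simp [Set.indicator, hp, hp']

lemma tendsto_integral_mul_setIntegral {g : ℝ → ℝ} (hg : Integrable g) :
    Tendsto (fun ε : ℝ => ∫ x, g x * ∫ y in {y : ℝ | ε < |x - y|}, g y)
      (nhdsWithin 0 (Set.Ioi 0)) (nhds ((∫ x, g x) ^ 2)) := by
  rw [sq, ← integral_mul_const]
  refine tendsto_integral_filter_of_dominated_convergence (fun x => ‖g x‖ * ∫ y, ‖g y‖)
    (Eventually.of_forall fun ε => ?_)
    (Eventually.of_forall fun ε => Eventually.of_forall fun x => ?_)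
    (hg.norm.mul_const _)
    (Eventually.of_forall fun x => (tendsto_setIntegral_lt_abs_sub hg x).const_mul _)
  · have hs : MeasurableSet {p : ℝ × ℝ | ε < |p.1 - p.2|} :=
      measurableSet_lt measurable_const (by fun_prop)
    refine ((hg.mul_prod hg).indicator hs).integral_prod_left.aestronglyMeasurable.congr
      (Eventually.of_forall fun x => ?_)
    simp only
    rw [← integral_indicator (measurableSet_lt_abs_sub ε x), ← integral_const_mul]
    congr 1 with y
    simp [Set.indicator]
  · rw [norm_mul]
    gcongr
    exact (norm_integral_le_integral_norm _).trans
      (setIntegral_le_integral hg.norm (Eventually.of_forall fun _ => norm_nonneg _))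

lemma LipschitzWith.tendsto_integral_truncatedHilbert_mul {f g h : ℝ → ℝ} {L : NNReal}
    (hL : LipschitzWith L f) (hf : Integrable f) (hg : Integrable g)
    (hlim : ∀ x, Tendsto (fun ε => truncatedHilbert f ε x) (nhdsWithin 0 (Set.Ioi 0))
      (nhds (h x))) :
    Tendsto (fun ε : ℝ => ∫ x, truncatedHilbert f ε x * g x)
      (nhdsWithin 0 (Set.Ioi 0)) (nhds (∫ x, h x * g x)) := by
  refine tendsto_integral_filter_of_dominated_convergence
    (fun x => (2 * L + ∫ y, |f y|) * ‖g x‖) ?_ ?_ (hg.norm.const_mul _)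
    (Eventually.of_forall fun x => (hlim x).mul_const _)
  · filter_upwards [self_mem_nhdsWithin] with ε hε
    have hI := (integrable_prod_truncated hf hg hε).integral_prod_left
    simp only [integral_indicator_prod_truncated] at hI
    exact hI.aestronglyMeasurable
  · filter_upwards [self_mem_nhdsWithin] with ε hε
    refine Eventually.of_forall fun x => ?_
    rw [norm_mul]
    gcongr
    exact hL.abs_truncatedHilbert_le hf hε x

theorem hilbert_pairing_identity (ω : SchwartzMap ℝ ℝ)
    (hodd : ∀ x : ℝ, ω (-x) = -ω x) (Hω : ℝ → ℝ)
    (hH : ∀ x : ℝ, Tendsto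
      (fun ε : ℝ => (1 / Real.pi) * ∫ y in {y : ℝ | ε < |x - y|}, ω y / (x - y))
      (nhdsWithin 0 (Set.Ioi 0)) (nhds (Hω x))) :
    (1 / Real.pi) * (∫ x : ℝ, Hω x * ω x / x) = -(1 / 2) * Hω 0 ^ 2 := by
  have hπ := Real.pi_ne_zero
  obtain ⟨L, hL⟩ := ω.exists_lipschitzWith
  have hω : Integrable ω := ω.integrable
  have hω0 : ω 0 = 0 := by
    have h := hodd 0
    rw [neg_zero] at h
    linarith
  have hg := hL.integrable_div_self hω hω0
  have hfg : ∀ x, ω x = x * (ω x / x) := fun x => by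
    rcases eq_or_ne x 0 with rfl | hx
    · simp [hω0]
    · field_simp
  have hlim : ∀ x, Tendsto (fun ε => truncatedHilbert ω ε x) (nhdsWithin 0 (Set.Ioi 0))
      (nhds (Real.pi * Hω x)) := fun x => by
    refine ((hH x).const_mul Real.pi).congr fun ε => ?_
    rw [truncatedHilbert]
    field_simp
  have hzero : Real.pi * Hω 0 = -∫ y, ω y / y := by
    refine tendsto_nhds_unique (hlim 0) ((tendsto_setIntegral_lt_abs_sub hg 0).neg.congr fun ε => ?_)
    rw [truncatedHilbert, ← integral_neg]
    simp only [zero_sub, div_neg]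
  have hpair : 2 * ∫ x, Real.pi * Hω x * (ω x / x) = -(∫ x, ω x / x) ^ 2 := by
    refine tendsto_nhds_unique
      ((hL.tendsto_integral_truncatedHilbert_mul hω hg hlim).const_mul 2)
      ((tendsto_integral_mul_setIntegral hg).neg.congr' ?_)
    filter_upwards [self_mem_nhdsWithin] with ε hε
    exact (two_mul_integral_truncatedHilbert_mul hω hg hfg hε).symm
  simp_rw [mul_assoc, integral_const_mul, ← mul_div_assoc] at hpair
  rw [show (∫ x, ω x / x) = -(Real.pi * Hω 0) by rw [hzero, neg_neg]] at hpair
  field_simp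
  refine mul_left_cancel₀ hπ ?_
  linarith
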